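/- arXiv:1112.2273 — 2 statements merged into one kernel-verified Lean document; each statement's English description precedes it below -/
import Mathlib

section
/- (Egawa–Kaneko–Matsumoto) Let H be a finite undirected graph on vertex set V, let s, t ∈ V be distinct vertices, and let ℓ ≥ 1 be an integer. Then H has an orientation D such that κ_D(s,t) ≥ ℓ and κ_D(t,s) ≥ ℓ if and only if λ_{H∖C}(s,t) ≥ 2(ℓ − |C|) for every C ⊆ V ∖ {s,t} with |C| < ℓ, where H∖C denotes the graph obtained from H by deleting the vertices of C. -/
/-- `D` is an orientation of the undirected graph `H`: each edge of `H` is assigned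
exactly one of its two possible directions. -/
def IsOrientation {V : Type*} (H : SimpleGraph V) (D : V → V → Prop) : Prop :=
  ∀ u v : V, (H.Adj u v ↔ (D u v ∨ D v u)) ∧ ¬ (D u v ∧ D v u)

/-- `l` is the list of arcs of a directed walk from `u` to `v` in the digraph `D`. -/
def IsDiWalk {V : Type*} (D : V → V → Prop) (u v : V) (l : List (V × V)) : Prop :=
  (∀ a ∈ l, D a.1 a.2) ∧ List.Chain' (fun a b : V × V => a.2 = b.1) l ∧
    ((l = [] ∧ u = v) ∨
      ((l.head?).map Prod.fst = some u ∧ (l.getLast?).map Prod.snd = some v))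

/-- `λ_H(u,v) ≥ n`: the undirected graph `H` contains `n` pairwise edge-disjoint
walks from `u` to `v`. -/
def HasFlow {V : Type*} (H : SimpleGraph V) (u v : V) (n : ℕ) : Prop :=
  ∃ f : Fin n → H.Walk u v, ∀ i j, i ≠ j → ∀ e, e ∈ (f i).edges → e ∉ (f j).edges

/-- The vertices visited by a directed walk starting at `u` with arc list `l`. -/
def diWalkVerts {V : Type*} (u : V) (l : List (V × V)) : List V := u :: l.map Prod.snd

/-- `κ_D(u,v) ≥ n`: the digraph `D` contains `n` pairwise internally node-disjoint
(and pairwise arc-disjoint) directed walks from `u` to `v`. -/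
def HasNodeDiFlow {V : Type*} (D : V → V → Prop) (u v : V) (n : ℕ) : Prop :=
  ∃ f : Fin n → List (V × V), (∀ i, IsDiWalk D u v (f i)) ∧
    (∀ i j, i ≠ j → ∀ a, a ∈ f i → a ∉ f j) ∧
    (∀ i j, i ≠ j → ∀ x, x ∈ diWalkVerts u (f i) → x ∈ diWalkVerts u (f j) → x = u ∨ x = v)

open Classical in
theorem ekm_linkage {X K : Type*} [Fintype X] [Fintype K] (R : X → X → Prop) (A B : X → Prop)
    (h : ∀ S : Finset X, (∀ x ∈ S, ¬ B x) →
      Fintype.card K ≤ (Finset.univ.filter fun x => x ∉ S ∧ (A x ∨ ∃ y ∈ S, R y x)).card) :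
    ∃ σ : Equiv.Perm (X ⊕ K), (∀ x y, σ (Sum.inl x) = Sum.inl y → x = y ∨ R x y) ∧
      (∀ k y, σ (Sum.inr k) = Sum.inl y → A y) ∧
      (∀ x k, σ (Sum.inl x) = Sum.inr k → B x) ∧
      (∀ k k', σ (Sum.inr k) ≠ Sum.inr k') := by
  let Rel : X ⊕ K → X ⊕ K → Prop := fun a b =>
    match a, b with
    | Sum.inl x, Sum.inl y => x = y ∨ R x y
    | Sum.inr _, Sum.inl y => A y
    | Sum.inl x, Sum.inr _ => B x
    | Sum.inr _, Sum.inr _ => False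
  obtain ⟨f, hf, hfR⟩ := (Finset.all_card_le_biUnion_card_iff_exists_injective
    (fun z : X ⊕ K => Finset.univ.filter (Rel z))).1 (by
      intro T
      by_cases h1 : ∃ x, Sum.inl x ∈ T ∧ B x
      · obtain ⟨b, hb, hB⟩ := h1
        apply Finset.card_le_card
        intro z hz
        rw [Finset.mem_biUnion]
        rcases z with x | k
        · exact ⟨Sum.inl x, hz, by simp [Rel]⟩
        · exact ⟨Sum.inl b, hb, by simpa [Rel] using hB⟩
      push Not at h1
      by_cases h2 : ∃ k, Sum.inr k ∈ T
      · obtain ⟨k, hk⟩ := h2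
        let S : Finset X := Finset.univ.filter fun x => Sum.inl x ∈ T
        have hS := h S (by intro x hx; exact h1 x (by simpa [S] using hx))
        set W := Finset.univ.filter fun x => x ∉ S ∧ (A x ∨ ∃ y ∈ S, R y x) with hW
        have hT : T.card ≤ S.card + Fintype.card K := by
          calc T.card ≤ (S.disjSum (Finset.univ : Finset K)).card := by
                apply Finset.card_le_card
                intro z hz
                rcases z with x | k
                · simpa [S] using hz
                · simp
            _ = _ := by simp [Finset.card_disjSum]
        have hd : Disjoint S W := by
          rw [Finset.disjoint_left]
          intro x hx hx'
          simp only [hW, Finset.mem_filter] at hx'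
          exact hx'.2.1 hx
        calc T.card ≤ S.card + W.card := by omega
          _ = ((S ∪ W).map ⟨Sum.inl, Sum.inl_injective⟩ : Finset (X ⊕ K)).card := by
            rw [Finset.card_map, Finset.card_union_of_disjoint hd]
          _ ≤ _ := by
            apply Finset.card_le_card
            intro z hz
            rw [Finset.mem_map] at hz
            obtain ⟨x, hx, rfl⟩ := hz
            rw [Finset.mem_biUnion]
            rw [Finset.mem_union] at hx
            rcases hx with hx | hx
            · exact ⟨Sum.inl x, by simpa [S] using hx, by simp [Rel]⟩
            · simp only [hW, Finset.mem_filter] at hx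
              rcases hx.2.2 with hA | ⟨y, hy, hR⟩
              · exact ⟨Sum.inr k, hk, by simpa [Rel] using hA⟩
              · exact ⟨Sum.inl y, by simpa [S] using hy, by simp [Rel, hR]⟩
      · push Not at h2
        apply Finset.card_le_card
        intro z hz
        rw [Finset.mem_biUnion]
        rcases z with x | k
        · exact ⟨Sum.inl x, hz, by simp [Rel]⟩
        · exact absurd hz (h2 k))
  have hR : ∀ z, Rel z (f z) := fun z => by simpa using hfR z
  refine ⟨Equiv.ofBijective f (Finite.injective_iff_bijective.1 hf), ?_, ?_, ?_, ?_⟩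
  · intro x y hxy
    have := hR (Sum.inl x)
    rw [Equiv.ofBijective_apply] at hxy
    rw [hxy] at this; exact this
  · intro x y hxy
    have := hR (Sum.inr x)
    rw [Equiv.ofBijective_apply] at hxy
    rw [hxy] at this; exact this
  · intro x y hxy
    have := hR (Sum.inl x)
    rw [Equiv.ofBijective_apply] at hxy
    rw [hxy] at this; exact this
  · intro x y hxy
    have := hR (Sum.inr x)
    rw [Equiv.ofBijective_apply] at hxy
    rw [hxy] at this; exact this

theorem ekm_return {X K : Type*} [Fintype X] [Fintype K] (σ : Equiv.Perm (X ⊕ K)) :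
    ∃ n : K → ℕ, (∀ k, 0 < n k) ∧ (∀ k, ∃ k', (σ ^ (n k)) (Sum.inr k) = Sum.inr k') ∧
      (∀ k j, 0 < j → j < n k → ∃ x, (σ ^ j) (Sum.inr k) = Sum.inl x) ∧
      (∀ k k' i j, i < n k → j < n k' → (σ ^ i) (Sum.inr k) = (σ ^ j) (Sum.inr k') →
        k = k' ∧ i = j) := by
  classical
  have ex : ∀ k : K, ∃ n, 0 < n ∧ ∃ k', (σ ^ n) (Sum.inr k) = Sum.inr k' := fun k =>
    ⟨orderOf σ, orderOf_pos σ, k, by rw [pow_orderOf_eq_one]; rfl⟩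
  have hin : ∀ k j, 0 < j → j < Nat.find (ex k) → ∃ x, (σ ^ j) (Sum.inr k) = Sum.inl x := by
    intro k j h0 hj
    have := Nat.find_min (ex k) hj
    rcases hx : (σ ^ j) (Sum.inr k) with x | k'
    · exact ⟨x, rfl⟩
    · exact absurd ⟨h0, k', hx⟩ this
  have key : ∀ k k' i j, i ≤ j → j < Nat.find (ex k') →
      (σ ^ i) (Sum.inr k) = (σ ^ j) (Sum.inr k') → k = k' ∧ i = j := by
    intro k k' i j hij hj he
    obtain ⟨d, rfl⟩ := Nat.exists_eq_add_of_le hij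
    rw [pow_add, Equiv.Perm.mul_apply] at he
    have he := (σ ^ i).injective he
    rcases Nat.eq_zero_or_pos d with rfl | hd
    · simp at he; exact ⟨he, rfl⟩
    · obtain ⟨x, hx⟩ := hin k' d hd (by omega)
      rw [hx] at he; cases he
  refine ⟨fun k => Nat.find (ex k), fun k => (Nat.find_spec (ex k)).1,
    fun k => (Nat.find_spec (ex k)).2, hin, ?_⟩
  intro k k' i j hi hj he
  rcases le_total i j with h | h
  · exact key k k' i j h hj he
  · obtain ⟨a, b⟩ := key k' k j i h hi he.symm
    exact ⟨a.symm, b.symm⟩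

theorem ekm_split {P : Type*} [Fintype P] (τ : P × Bool → P × Bool) (hτ : Function.Injective τ) :
    ∃ c : P → Bool, Function.Bijective (fun p => (τ (p, c p)).1) ∧
      Function.Bijective (fun p => (τ (p, !(c p))).1) := by
  classical
  obtain ⟨g, hg, hgt⟩ := (Finset.all_card_le_biUnion_card_iff_exists_injective
    (fun p : P => ({(τ (p, false)).1, (τ (p, true)).1} : Finset P))).1 (by
      intro A
      have h1 : ((A ×ˢ (Finset.univ : Finset Bool)).image τ).card = A.card * 2 := by
        rw [Finset.card_image_of_injective _ hτ]; simp
      have h2 : ((A ×ˢ (Finset.univ : Finset Bool)).image τ) ⊆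
          ((A.biUnion fun p : P => ({(τ (p, false)).1, (τ (p, true)).1} : Finset P)) ×ˢ
            (Finset.univ : Finset Bool)) := by
        intro y hy
        rw [Finset.mem_image] at hy
        obtain ⟨⟨p, b⟩, hp, rfl⟩ := hy
        simp only [Finset.mem_product, Finset.mem_univ, and_true, Finset.mem_biUnion] at hp ⊢
        refine ⟨p, hp, ?_⟩
        cases b <;> simp
      have h3 := Finset.card_le_card h2
      rw [h1, Finset.card_product] at h3
      simp only [Finset.card_univ, Fintype.card_bool] at h3
      omega)
  have hc : ∀ p, ∃ b, (τ (p, b)).1 = g p := by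
    intro p
    have := hgt p
    simp only [Finset.mem_insert, Finset.mem_singleton] at this
    rcases this with h | h
    · exact ⟨_, h.symm⟩
    · exact ⟨_, h.symm⟩
  choose c hc using hc
  have hgb := Finite.injective_iff_bijective.1 hg
  refine ⟨c, by simpa [hc] using hgb, Finite.injective_iff_bijective.1 ?_⟩
  intro p p' hpp
  by_contra hne
  obtain ⟨r, hr⟩ := hgb.2 (τ (p, !(c p))).1
  simp only at hpp
  rw [← hc r] at hr
  have n1 : (τ (p, !(c p))).2 ≠ (τ (p', !(c p'))).2 := by
    intro h
    have := hτ (Prod.ext hpp h)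
    exact hne (Prod.mk.inj this).1
  have n2 : (τ (r, c r)).2 ≠ (τ (p, !(c p))).2 := by
    intro h
    have := Prod.mk.inj (hτ (Prod.ext hr h))
    rw [this.1] at this
    simp at this
  have n3 : (τ (r, c r)).2 ≠ (τ (p', !(c p'))).2 := by
    intro h
    have := Prod.mk.inj (hτ (Prod.ext (hr.trans hpp) h))
    rw [this.1] at this
    simp at this
  revert n1 n2 n3
  generalize (τ (p, !(c p))).2 = a
  generalize (τ (p', !(c p'))).2 = b
  generalize (τ (r, c r)).2 = d
  revert a b d
  decide

/-- departure / arrival vertex -/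
def ekmEnd {V K : Type*} (s : V) : V ⊕ K → V
  | Sum.inl v => v
  | Sum.inr _ => s

theorem ekm_extract {V : Type*} [Fintype V] (D : V → V → Prop) (s t : V) (ℓ : ℕ)
    (π : Equiv.Perm (V ⊕ Fin ℓ))
    (h1 : ∀ p, π p = p ∧ (∃ v, p = Sum.inl v) ∨ D (ekmEnd s p) (ekmEnd t (π p)))
    (h2 : ∀ p p', ¬ (π p = p ∧ (∃ v, p = Sum.inl v)) → ¬ (π p' = p' ∧ (∃ v, p' = Sum.inl v)) →
      ekmEnd s p = ekmEnd s p' → ekmEnd t (π p) = ekmEnd t (π p') → p = p') :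
    HasNodeDiFlow D s t ℓ := by
  obtain ⟨n, hn0, hnr, hnl, hdis⟩ := ekm_return π
  have hmov : ∀ k j, j < n k → ¬ (π ((π ^ j) (Sum.inr k)) = (π ^ j) (Sum.inr k) ∧
      (∃ v, (π ^ j) (Sum.inr k) = Sum.inl v)) := by
    rintro k j hj ⟨h, v, hv⟩
    have hfix : ∀ m, (π ^ m) ((π ^ j) (Sum.inr k)) = (π ^ j) (Sum.inr k) := by
      intro m
      induction m with
      | zero => rfl
      | succ m ih => rw [pow_succ, Equiv.Perm.mul_apply, h, ih]
    obtain ⟨k', hk'⟩ := hnr k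
    have := hfix (n k - j)
    rw [← Equiv.Perm.mul_apply, ← pow_add, Nat.sub_add_cancel hj.le, hk', hv] at this
    cases this
  have hss : ∀ k j, π ((π ^ j) (Sum.inr k)) = (π ^ (j+1)) (Sum.inr k) := by
    intro k j; rw [pow_succ', Equiv.Perm.mul_apply]
  refine ⟨fun k => (List.range (n k)).map fun j =>
    (ekmEnd s ((π ^ j) (Sum.inr k)), ekmEnd t ((π ^ (j+1)) (Sum.inr k))), ?_, ?_, ?_⟩
  · intro k
    refine ⟨?_, ?_, Or.inr ⟨?_, ?_⟩⟩
    · intro a ha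
      rw [List.mem_map] at ha
      obtain ⟨j, hj, rfl⟩ := ha
      rw [List.mem_range] at hj
      have := (h1 ((π ^ j) (Sum.inr k))).resolve_left (hmov k j hj)
      rw [hss] at this
      exact this
    · show List.IsChain _ _
      rw [List.isChain_iff_getElem]
      intro i hi
      simp only [List.length_map, List.length_range] at hi
      obtain ⟨x, hx⟩ := hnl k (i+1) (by omega) (by omega)
      simp [hx, ekmEnd]
    · beta_reduce
      obtain ⟨m, hm⟩ := Nat.exists_eq_succ_of_ne_zero (hn0 k).ne'
      rw [hm, List.range_succ_eq_map]
      simp [ekmEnd]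
    · beta_reduce
      obtain ⟨m, hm⟩ := Nat.exists_eq_succ_of_ne_zero (hn0 k).ne'
      obtain ⟨k', hk'⟩ := hnr k
      rw [hm] at hk'
      rw [hm, List.range_succ]
      simp only [Nat.succ_eq_add_one] at hk'
      simp [hk', ekmEnd]
  · intro k k' hk a ha ha'
    rw [List.mem_map] at ha ha'
    obtain ⟨j, hj, rfl⟩ := ha
    obtain ⟨j', hj', he⟩ := ha'
    rw [List.mem_range] at hj hj'
    have e := Prod.mk.inj he
    have := h2 _ _ (hmov k' j' hj') (hmov k j hj) e.1 (by rw [hss, hss]; exact e.2)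
    exact hk (hdis _ _ _ _ hj' hj this).1.symm
  · intro k k' hk x hx hx'
    by_contra hcon
    push Not at hcon
    have aux : ∀ k, x ∈ diWalkVerts s ((List.range (n k)).map fun j =>
        (ekmEnd s ((π ^ j) (Sum.inr k)), ekmEnd t ((π ^ (j+1)) (Sum.inr k)))) →
        ∃ j, j < n k ∧ (π ^ j) (Sum.inr k) = Sum.inl x := by
      intro k hx
      simp only [diWalkVerts, List.mem_cons, List.mem_map, List.mem_range, exists_exists_and_eq_and] at hx
      rcases hx with hx | ⟨j, hj, hx⟩
      · exact absurd hx hcon.1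
      · refine ⟨j+1, ?_, ?_⟩
        · rcases Nat.lt_or_ge (j+1) (n k) with h | h
          · exact h
          · obtain ⟨k', hk'⟩ := hnr k
            have : n k = j+1 := by omega
            rw [this] at hk'
            rw [hk'] at hx
            exact absurd hx.symm hcon.2
        · rcases hq : (π ^ (j+1)) (Sum.inr k) with y | y
          · rw [hq] at hx; simp only [ekmEnd] at hx; rw [hx]
          · rw [hq] at hx; exact absurd hx.symm hcon.2
    obtain ⟨j, hj, e⟩ := aux k hx
    obtain ⟨j', hj', e'⟩ := aux k' hx'
    exact hk (hdis _ _ _ _ hj hj' (e.trans e'.symm)).1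

theorem ekm_pigeon {V : Type*} {G : SimpleGraph V} {s t : V} {n : ℕ} (h : HasFlow G s t n)
    (F : Finset (Sym2 V)) (hF : F.card < n) :
    ∃ w : G.Walk s t, ∀ e ∈ w.edges, e ∉ F := by
  classical
  obtain ⟨f, hf⟩ := h
  by_contra hcon
  push Not at hcon
  choose g hg hgF using fun i => hcon (f i)
  have : Function.Injective (fun i => (⟨g i, hgF i⟩ : F)) := by
    intro i j hij
    by_contra hne
    have : g i = g j := congrArg Subtype.val hij
    exact hf i j hne (g i) (hg i) (this ▸ hg j)
  have := Fintype.card_le_of_injective _ this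
  simp at this
  omega

def ekmR {V : Type*} (H : SimpleGraph V) (s t : V) :
    (V × Bool) ⊕ Sym2 V → (V × Bool) ⊕ Sym2 V → Prop
  | Sum.inl v, Sum.inr e => e ∈ H.edgeSet ∧ v.1 ∈ e ∧ v.1 ≠ s ∧ v.1 ≠ t
  | Sum.inr e, Sum.inl v => e ∈ H.edgeSet ∧ v.1 ∈ e ∧ v.1 ≠ s ∧ v.1 ≠ t
  | _, _ => False

def ekmA {V : Type*} (H : SimpleGraph V) (s : V) : (V × Bool) ⊕ Sym2 V → Prop
  | Sum.inl _ => False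
  | Sum.inr e => e ∈ H.edgeSet ∧ s ∈ e

open Classical in
theorem ekm_cut {V : Type*} [Fintype V]
    (H : SimpleGraph V) (s t : V) (hst : s ≠ t) (ℓ : ℕ)
    (h : ∀ C : Finset V, s ∉ C → t ∉ C → C.card < ℓ →
        HasFlow (SimpleGraph.fromRel fun a b => H.Adj a b ∧ a ∉ C ∧ b ∉ C) s t
          (2 * (ℓ - C.card)))
    (S : Finset ((V × Bool) ⊕ Sym2 V)) (hS : ∀ x ∈ S, ¬ ekmA H t x) :
    2 * ℓ ≤ (Finset.univ.filter fun x => x ∉ S ∧ (ekmA H s x ∨ ∃ y ∈ S, ekmR H s t y x)).card := by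
  set W := Finset.univ.filter fun x => x ∉ S ∧ (ekmA H s x ∨ ∃ y ∈ S, ekmR H s t y x) with hW
  by_contra hlt
  push Not at hlt
  let C : Finset V := Finset.univ.filter fun v => Sum.inl (v, true) ∈ W ∧ Sum.inl (v, false) ∈ W
  let F : Finset (Sym2 V) := Finset.univ.filter fun e => Sum.inr e ∈ W
  have hCW : ∀ v b, Sum.inl (v, b) ∈ W → v ≠ s ∧ v ≠ t := by
    intro v b hv
    simp only [hW, Finset.mem_filter] at hv
    rcases hv.2.2 with h | ⟨y, hy, h⟩
    · exact h.elim
    · rcases y with y | e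
      · exact h.elim
      · exact h.2.2
  have hcard : 2 * C.card + F.card ≤ W.card := by
    have : ((C ×ˢ (Finset.univ : Finset Bool)).disjSum F) ⊆ W := by
      intro z hz
      rcases z with ⟨v, b⟩ | e
      · simp only [Finset.inl_mem_disjSum, Finset.mem_product, C, Finset.mem_filter] at hz
        cases b
        · exact hz.1.2.2
        · exact hz.1.2.1
      · simp only [Finset.inr_mem_disjSum, F, Finset.mem_filter] at hz
        exact hz.2
    have := Finset.card_le_card this
    rw [Finset.card_disjSum, Finset.card_product] at this
    simp only [Finset.card_univ, Fintype.card_bool] at this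
    omega
  obtain ⟨w, hw⟩ := ekm_pigeon (h C
    (fun hs => (hCW s true (Finset.mem_filter.1 hs).2.1).1 rfl)
    (fun hs => (hCW t true (Finset.mem_filter.1 hs).2.1).2 rfl) (by omega)) F (by omega)
  have key : ∀ (a b : V) (w : (SimpleGraph.fromRel fun a b => H.Adj a b ∧ a ∉ C ∧ b ∉ C).Walk a b),
      (∀ e ∈ w.edges, e ∉ F) → b = t →
      (a = s ∨ (a ≠ s ∧ a ≠ t ∧ ∃ i, Sum.inl (a, i) ∈ S)) → False := by
    intro a b w
    induction w with
    | nil =>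
      rintro - rfl h
      rcases h with h | h
      · exact hst h.symm
      · exact h.2.1 rfl
    | @cons u v x huv p ih =>
      intro hF hx hu
      rw [SimpleGraph.fromRel_adj] at huv
      have hadj : H.Adj u v ∧ u ∉ C ∧ v ∉ C := by
        rcases huv.2 with h | h
        · exact h
        · exact ⟨h.1.symm, h.2.2, h.2.1⟩
      have heF : s(u, v) ∉ F := hF _ (by simp)
      have heS : Sum.inr s(u, v) ∈ S := by
        by_contra hn
        apply heF
        simp only [F, hW, Finset.mem_filter, Finset.mem_univ, true_and]
        refine ⟨hn, ?_⟩
        rcases hu with rfl | ⟨h1, h2, i, hi⟩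
        · exact Or.inl ⟨hadj.1, by simp⟩
        · exact Or.inr ⟨_, hi, hadj.1, by simp, h1, h2⟩
      apply ih (fun e he => hF e (by simp [he])) hx
      by_cases hvs : v = s
      · exact Or.inl hvs
      · have hvt : v ≠ t := by
          rintro rfl
          exact hS _ heS ⟨hadj.1, by simp⟩
        refine Or.inr ⟨hvs, hvt, ?_⟩
        by_contra hn
        push Not at hn
        apply hadj.2.2
        simp only [C, hW, Finset.mem_filter, Finset.mem_univ, true_and]
        exact ⟨⟨hn _, Or.inr ⟨_, heS, hadj.1, by simp, hvs, hvt⟩⟩,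
          ⟨hn _, Or.inr ⟨_, heS, hadj.1, by simp, hvs, hvt⟩⟩⟩
  exact key s t w hw rfl (Or.inl rfl)

def ekmI {V K : Type*} : (V ⊕ K) × Bool → ((V × Bool) ⊕ Sym2 V) ⊕ (K × Bool)
  | (Sum.inl v, b) => Sum.inl (Sum.inl (v, b))
  | (Sum.inr k, b) => Sum.inr (k, b)

theorem ekmI_inj {V K : Type*} : Function.Injective (@ekmI V K) := by
  rintro ⟨v | k, b⟩ ⟨v' | k', b'⟩ h <;> simp_all [ekmI]

theorem ekm_tau {V : Type*} [Fintype V]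
    (H : SimpleGraph V) (s t : V) (hst : s ≠ t) (ℓ : ℕ)
    (h : ∀ C : Finset V, s ∉ C → t ∉ C → C.card < ℓ →
        HasFlow (SimpleGraph.fromRel fun a b => H.Adj a b ∧ a ∉ C ∧ b ∉ C) s t
          (2 * (ℓ - C.card))) :
    ∃ τ : (V ⊕ Fin ℓ) × Bool → (V ⊕ Fin ℓ) × Bool, Function.Injective τ ∧
      (∀ y, (τ y).1 = y.1 ∧ (∃ v, y.1 = Sum.inl v) ∨
        H.Adj (ekmEnd s y.1) (ekmEnd t (τ y).1)) ∧
      (∀ y z, ¬ ((τ y).1 = y.1 ∧ (∃ v, y.1 = Sum.inl v)) →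
        ¬ ((τ z).1 = z.1 ∧ (∃ v, z.1 = Sum.inl v)) →
        s(ekmEnd s y.1, ekmEnd t (τ y).1) = s(ekmEnd s z.1, ekmEnd t (τ z).1) → y = z) := by
  classical
  obtain ⟨σ, s1, s2, s3, s4⟩ := ekm_linkage (K := Fin ℓ × Bool) (ekmR H s t) (ekmA H s) (ekmA H t) (by
    intro S hS
    have := ekm_cut H s t hst ℓ h S hS
    simp only [Fintype.card_prod, Fintype.card_fin, Fintype.card_bool]
    rw [mul_comm]
    convert this)
  have hsplit : ∀ z : ((V × Bool) ⊕ Sym2 V) ⊕ (Fin ℓ × Bool),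
      (∃ y, z = ekmI y) ∨ ∃ e, z = Sum.inl (Sum.inr e) := by
    rintro ((⟨v, b⟩ | e) | ⟨k, b⟩)
    · exact Or.inl ⟨(Sum.inl v, b), rfl⟩
    · exact Or.inr ⟨e, rfl⟩
    · exact Or.inl ⟨(Sum.inr k, b), rfl⟩
  have hIe : ∀ (y : (V ⊕ Fin ℓ) × Bool) e, ekmI y ≠ Sum.inl (Sum.inr e) := by
    rintro ⟨v | k, b⟩ e h <;> simp [ekmI] at h
  -- direct steps
  have hdir : ∀ y y', σ (ekmI y) = ekmI y' → y'.1 = y.1 ∧ ∃ v, y.1 = Sum.inl v := by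
    rintro ⟨v | k, b⟩ ⟨v' | k', b'⟩ he
    · rcases s1 _ _ he with h | h
      · simp only [Sum.inl.injEq, Prod.mk.injEq] at h
        simp [h.1]
      · exact h.elim
    · exact (s3 _ _ he).elim
    · exact (s2 _ _ he).elim
    · exact (s4 _ _ he).elim
  have hout : ∀ y e, σ (ekmI y) = Sum.inl (Sum.inr e) →
      e ∈ H.edgeSet ∧ ekmEnd s y.1 ∈ e ∧ (∀ v, y.1 = Sum.inl v → v ≠ t ∧ v ≠ s) := by
    rintro ⟨v | k, b⟩ e he
    · rcases s1 _ _ he with h | h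
      · cases h
      · exact ⟨h.1, h.2.1, by rintro _ ⟨⟩; exact ⟨h.2.2.2, h.2.2.1⟩⟩
    · have := s2 _ _ he
      exact ⟨this.1, this.2, by rintro _ ⟨⟩⟩
  have hin : ∀ y e, σ (Sum.inl (Sum.inr e)) = ekmI y →
      e ∈ H.edgeSet ∧ ekmEnd t y.1 ∈ e ∧ (∀ v, y.1 = Sum.inl v → v ≠ t ∧ v ≠ s) := by
    rintro ⟨v | k, b⟩ e he
    · rcases s1 _ _ he with h | h
      · cases h
      · exact ⟨h.1, h.2.1, by rintro _ ⟨⟩; exact ⟨h.2.2.2, h.2.2.1⟩⟩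
    · have := s3 _ _ he
      exact ⟨this.1, this.2, by rintro _ ⟨⟩⟩
  have hτ : ∀ y, ∃ y', σ (ekmI y) = ekmI y' ∨
      ∃ e, σ (ekmI y) = Sum.inl (Sum.inr e) ∧ σ (Sum.inl (Sum.inr e)) = ekmI y' := by
    intro y
    rcases hsplit (σ (ekmI y)) with ⟨y', hy'⟩ | ⟨e, he⟩
    · exact ⟨y', Or.inl hy'⟩
    · rcases hsplit (σ (Sum.inl (Sum.inr e))) with ⟨y', hy'⟩ | ⟨e', he'⟩
      · exact ⟨y', Or.inr ⟨e, he, hy'⟩⟩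
      · exfalso
        rcases s1 _ _ he' with h | h
        · cases h
          have := σ.injective (he.trans he'.symm)
          exact hIe _ _ this
        · exact h
  choose τ hτ using hτ
  have hstep : ∀ y, ¬ ((τ y).1 = y.1 ∧ (∃ v, y.1 = Sum.inl v)) →
      H.Adj (ekmEnd s y.1) (ekmEnd t (τ y).1) ∧
      σ (ekmI y) = Sum.inl (Sum.inr s(ekmEnd s y.1, ekmEnd t (τ y).1)) := by
    intro y hy
    rcases hτ y with h | ⟨e, he, he'⟩
    · exact absurd (hdir _ _ h) hy
    · obtain ⟨a1, a2, a3⟩ := hout _ _ he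
      obtain ⟨b1, b2, b3⟩ := hin _ _ he'
      have hne : ekmEnd s y.1 ≠ ekmEnd t (τ y).1 := by
        intro heq
        apply hy
        rcases hp : y.1 with v | k <;> rcases hq : (τ y).1 with v' | k' <;>
          rw [hp, hq] at heq <;> simp only [ekmEnd] at heq
        · exact ⟨by rw [heq], v, rfl⟩
        · exact absurd heq (a3 v hp).1
        · exact absurd heq.symm (b3 v' hq).2
        · exact absurd heq hst
      have hee : e = s(ekmEnd s y.1, ekmEnd t (τ y).1) := (Sym2.mem_and_mem_iff hne).1 ⟨a2, b2⟩
      rw [hee] at a1 he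
      exact ⟨a1, he⟩
  refine ⟨τ, ?_, ?_, ?_⟩
  · intro y z hyz
    have h1 := hτ y
    have h2 := hτ z
    rw [← hyz] at h2
    rcases h1 with h1 | ⟨e, he, he'⟩ <;> rcases h2 with h2 | ⟨e2, he2, he2'⟩
    · exact ekmI_inj (σ.injective (h1.trans h2.symm))
    · exact absurd (σ.injective (h1.trans he2'.symm)) (hIe _ _)
    · exact absurd (σ.injective (h2.trans he'.symm)) (hIe _ _)
    · have := σ.injective (he'.trans he2'.symm)
      rw [← this] at he2
      exact ekmI_inj (σ.injective (he.trans he2.symm))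
  · intro y
    by_cases hy : ((τ y).1 = y.1 ∧ (∃ v, y.1 = Sum.inl v))
    · exact Or.inl hy
    · exact Or.inr (hstep y hy).1
  · intro y z hy hz he
    have h1 := (hstep y hy).2
    have h2 := (hstep z hz).2
    rw [he] at h1
    exact ekmI_inj (σ.injective (h1.trans h2.symm))

theorem ekm_orient {V : Type*} [Fintype V] (H : SimpleGraph V) (F : V → V → Prop)
    (h1 : ∀ a b, F a b → H.Adj a b) (h2 : ∀ a b, F a b → ¬ F b a) :
    ∃ D : V → V → Prop, IsOrientation H D ∧ ∀ a b, F a b → D a b := by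
  let e := Fintype.equivFin V
  refine ⟨fun a b => F a b ∨ (H.Adj a b ∧ ¬ F b a ∧ e a < e b), ?_, fun a b h => Or.inl h⟩
  intro u v
  constructor
  · constructor
    · intro h
      have hne : e u ≠ e v := fun hh => h.ne (e.injective hh)
      have := h.symm
      rcases lt_or_gt_of_ne hne with hl | hl <;> tauto
    · rintro ((h | h) | (h | h))
      · exact h1 _ _ h
      · exact h.1
      · exact (h1 _ _ h).symm
      · exact h.1.symm
  · rintro ⟨h | h, h' | h'⟩
    · exact h2 _ _ h h'
    · exact h'.2.1 h
    · exact h.2.1 h'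
    · exact absurd h.2.2 (lt_asymm h'.2.2)

theorem ekm_suff {V : Type*} [Fintype V]
    (H : SimpleGraph V) (s t : V) (hst : s ≠ t) (ℓ : ℕ)
    (h : ∀ C : Finset V, s ∉ C → t ∉ C → C.card < ℓ →
        HasFlow (SimpleGraph.fromRel fun a b => H.Adj a b ∧ a ∉ C ∧ b ∉ C) s t
          (2 * (ℓ - C.card))) :
    ∃ D : V → V → Prop, IsOrientation H D ∧
        HasNodeDiFlow D s t ℓ ∧ HasNodeDiFlow D t s ℓ := by
  obtain ⟨τ, hτ, t1, t2⟩ := ekm_tau H s t hst ℓ h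
  obtain ⟨c, c1, c2⟩ := ekm_split τ hτ
  let St : (V ⊕ Fin ℓ) × Bool → Prop := fun y => (τ y).1 = y.1 ∧ (∃ v, y.1 = Sum.inl v)
  have t1' : ∀ y, ¬ St y → H.Adj (ekmEnd s y.1) (ekmEnd t (τ y).1) :=
    fun y hy => (t1 y).resolve_left hy
  obtain ⟨D, hD, hFD⟩ := ekm_orient H (fun a b =>
    (∃ p, ¬ St (p, c p) ∧ a = ekmEnd s p ∧ b = ekmEnd t (τ (p, c p)).1) ∨
    (∃ p, ¬ St (p, !(c p)) ∧ b = ekmEnd s p ∧ a = ekmEnd t (τ (p, !(c p))).1)) (by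
      rintro a b (⟨p, hp, rfl, rfl⟩ | ⟨p, hp, rfl, rfl⟩)
      · exact t1' _ hp
      · exact (t1' _ hp).symm) (by
      rintro a b (⟨p, hp, rfl, rfl⟩ | ⟨p, hp, rfl, rfl⟩) (⟨q, hq, e1, e2⟩ | ⟨q, hq, e1, e2⟩)
      · have := t2 _ _ hp hq (by simp only; rw [e1, e2, Sym2.eq_swap])
        have := (Prod.mk.inj this).1
        subst this
        exact (t1' _ hp).ne e2
      · have := t2 _ _ hp hq (by simp only; rw [e1, e2])
        have := Prod.mk.inj this
        rw [this.1] at this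
        simp at this
      · have := t2 _ _ hp hq (by simp only; rw [e1, e2])
        have := Prod.mk.inj this
        rw [this.1] at this
        simp at this
      · have := t2 _ _ hp hq (by simp only; rw [e1, e2, Sym2.eq_swap])
        have := (Prod.mk.inj this).1
        subst this
        exact (t1' _ hp).ne e1.symm)
  refine ⟨D, hD, ?_, ?_⟩
  · apply ekm_extract D s t ℓ (Equiv.ofBijective _ c1)
    · intro p
      simp only [Equiv.ofBijective_apply]
      by_cases hp : St (p, c p)
      · exact Or.inl hp
      · exact Or.inr (hFD _ _ (Or.inl ⟨p, hp, rfl, rfl⟩))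
    · intro p q hp hq e1 e2
      simp only [Equiv.ofBijective_apply] at hp hq e1 e2
      exact (Prod.mk.inj (t2 _ _ hp hq (by simp only; rw [e1, e2]))).1
  · let π := Equiv.ofBijective _ c2
    have hπ : ∀ p, π p = (τ (p, !(c p))).1 := fun p => rfl
    have hnst : ∀ q, ¬ (π.symm q = q ∧ ∃ v, q = Sum.inl v) →
        ¬ St (π.symm q, !(c (π.symm q))) := by
      intro q hq hs
      apply hq
      obtain ⟨hs1, v, hv⟩ := hs
      rw [← hπ, Equiv.apply_symm_apply] at hs1
      simp only at hs1 hv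
      exact ⟨hs1.symm, v, hs1.trans hv⟩
    have hπ' : ∀ q, (τ (π.symm q, !(c (π.symm q)))).1 = q := by
      intro q; rw [← hπ, Equiv.apply_symm_apply]
    apply ekm_extract D t s ℓ π.symm
    · intro q
      by_cases hq : π.symm q = q ∧ ∃ v, q = Sum.inl v
      · exact Or.inl hq
      · exact Or.inr (hFD _ _ (Or.inr ⟨π.symm q, hnst q hq, rfl, by rw [hπ']⟩))
    · intro p q hp hq e1 e2
      have := (Prod.mk.inj (t2 _ _ (hnst p hp) (hnst q hq)
        (by simp only; rw [hπ', hπ', e1, e2]))).1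
      exact π.symm.injective this

open Classical in
theorem ekm_menger {V : Type*} [Fintype V] (G : SimpleGraph V) (s t : V) (n : ℕ)
    (h : ∀ U : Finset V, s ∈ U → t ∉ U →
      n ≤ (Finset.univ.filter fun p : V × V => p.1 ∈ U ∧ p.2 ∉ U ∧ G.Adj p.1 p.2).card)
    (hst : s ≠ t) : HasFlow G s t n := by
  obtain ⟨σ, s1, s2, s3, s4⟩ := ekm_linkage (K := Fin n)
    (fun e f : Sym2 V => f ∈ G.edgeSet ∧ e ∈ G.edgeSet ∧ ∃ v, v ∈ e ∧ v ∈ f)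
    (fun e => e ∈ G.edgeSet ∧ s ∈ e) (fun e => e ∈ G.edgeSet ∧ t ∈ e) (by
      intro S hS
      rw [Fintype.card_fin]
      let U : Finset V := Finset.univ.filter fun v =>
        v = s ∨ ∃ e ∈ S, e ∈ G.edgeSet ∧ v ∈ e
      refine (h U (by simp [U]) ?_).trans ?_
      · simp only [U, Finset.mem_filter, Finset.mem_univ, true_and, not_or]
        refine ⟨hst.symm, ?_⟩
        rintro ⟨e, he, h1, h2⟩
        exact hS e he ⟨h1, h2⟩
      · apply Finset.card_le_card_of_injOn (fun p => s(p.1, p.2))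
        · rintro ⟨a, b⟩ hp
          simp only [Finset.coe_filter, Finset.mem_univ, true_and, Set.mem_setOf_eq] at hp ⊢
          obtain ⟨ha, hb, hab⟩ := hp
          refine ⟨?_, ?_⟩
          · intro he
            apply hb
            simp only [U, Finset.mem_filter, Finset.mem_univ, true_and]
            exact Or.inr ⟨_, he, hab, by simp⟩
          · simp only [U, Finset.mem_filter, Finset.mem_univ, true_and] at ha
            rcases ha with rfl | ⟨e, he, h1, h2⟩
            · exact Or.inl ⟨hab, by simp⟩
            · exact Or.inr ⟨e, he, hab, h1, a, h2, by simp⟩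
        · rintro ⟨a, b⟩ hp ⟨a', b'⟩ hp' heq
          simp only [Finset.coe_filter, Finset.mem_univ, true_and, Set.mem_setOf_eq] at hp hp'
          simp only [Sym2.eq_iff] at heq
          rcases heq with ⟨rfl, rfl⟩ | ⟨rfl, rfl⟩
          · rfl
          · exact absurd hp.1 hp'.2.1)
  obtain ⟨m, hm0, hmr, hml, hdis⟩ := ekm_return σ
  have hext : ∀ (P : Sym2 V → Prop) (u v : V) (e : Sym2 V), u ∈ e → v ∈ e → e ∈ G.edgeSet → P e →
      (∃ w : G.Walk s u, ∀ f ∈ w.edges, P f) → ∃ w : G.Walk s v, ∀ f ∈ w.edges, P f := by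
    rintro P u v e hu hv he hP ⟨w, hw⟩
    by_cases huv : u = v
    · subst huv; exact ⟨w, hw⟩
    · have hee := (Sym2.mem_and_mem_iff huv).1 ⟨hu, hv⟩
      subst hee
      rw [SimpleGraph.mem_edgeSet] at he
      refine ⟨w.concat he, ?_⟩
      intro f hf
      rw [SimpleGraph.Walk.edges_concat] at hf
      simp only [List.concat_eq_append, List.mem_append, List.mem_singleton] at hf
      rcases hf with hf | rfl
      · exact hw f hf
      · exact hP
  have key : ∀ k j, 0 < j → j < m k → ∀ e, (σ ^ j) (Sum.inr k) = Sum.inl e → ∀ v ∈ e,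
      ∃ w : G.Walk s v, ∀ f ∈ w.edges, ∃ i, i < m k ∧ (σ ^ i) (Sum.inr k) = Sum.inl f := by
    intro k j
    induction j with
    | zero => intro h; omega
    | succ j ih =>
      intro _ hj e he v hv
      rcases Nat.eq_zero_or_pos j with rfl | hj0
      · have hA := s2 k e (by simpa using he)
        exact hext _ s v e hA.2 hv hA.1 ⟨_, hj, he⟩ ⟨SimpleGraph.Walk.nil, by simp⟩
      · obtain ⟨e', he'⟩ := hml k j hj0 (by omega)
        have hs : σ (Sum.inl e') = Sum.inl e := by
          rw [← he, pow_succ', Equiv.Perm.mul_apply, he']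
        rcases s1 _ _ hs with rfl | ⟨h1, h2, u, hu, hu'⟩
        · exact ih hj0 (by omega) _ he' v hv
        · exact hext _ u v e hu' hv h1 ⟨_, hj, he⟩ (ih hj0 (by omega) _ he' u hu)
  have hw : ∀ k, ∃ w : G.Walk s t, ∀ f ∈ w.edges,
      ∃ i, i < m k ∧ (σ ^ i) (Sum.inr k) = Sum.inl f := by
    intro k
    obtain ⟨j, hj⟩ := Nat.exists_eq_succ_of_ne_zero (hm0 k).ne'
    obtain ⟨k', hk'⟩ := hmr k
    rw [hj] at hk'
    rcases Nat.eq_zero_or_pos j with rfl | hj0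
    · exact absurd (by simpa using hk') (s4 k k')
    · obtain ⟨e, he⟩ := hml k j hj0 (by omega)
      have hs : σ (Sum.inl e) = Sum.inr k' := by
        rw [← hk', Nat.succ_eq_add_one, pow_succ', Equiv.Perm.mul_apply, he]
      exact key k j hj0 (by omega) e he t (s3 _ _ hs).2
  choose f hf using hw
  refine ⟨f, ?_⟩
  intro k k' hk e he he'
  obtain ⟨i, hi, h1⟩ := hf k e he
  obtain ⟨i', hi', h2⟩ := hf k' e he'
  exact hk (hdis _ _ _ _ hi hi' (h1.trans h2.symm)).1

theorem ekm_cross {V : Type*} (D : V → V → Prop) (U : Finset V) (v : V) (hv : v ∉ U)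
    (l : List (V × V)) : ∀ u, u ∈ U → IsDiWalk D u v l → ∃ a ∈ l, a.1 ∈ U ∧ a.2 ∉ U := by
  induction l with
  | nil =>
    rintro u hu ⟨-, -, h⟩
    rcases h with h | h
    · exact absurd (h.2 ▸ hu) hv
    · simp at h
  | cons a l ih =>
    rintro u hu ⟨h1, h2, h⟩
    rcases h with h | h
    · simp at h
    have hau : a.1 = u := by simpa using h.1
    by_cases ha : a.2 ∈ U
    · obtain ⟨b, hb, hb'⟩ := ih a.2 ha (by
        refine ⟨fun b hb => h1 b (by simp [hb]), ?_, ?_⟩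
        · exact List.IsChain.tail h2
        · rcases l with _ | ⟨b, l⟩
          · left
            refine ⟨rfl, ?_⟩
            simpa using h.2
          · right
            refine ⟨?_, ?_⟩
            · have h2 : List.IsChain _ _ := h2
              rw [List.isChain_cons_cons] at h2
              simp [h2.1]
            · have := h.2
              rwa [List.getLast?_cons_cons] at this)
      exact ⟨b, by simp [hb], hb'⟩
    · exact ⟨a, by simp, hau ▸ hu, ha⟩

theorem ekm_verts {V : Type*} (D : V → V → Prop) (v : V)
    (l : List (V × V)) : ∀ u, IsDiWalk D u v l → ∀ a ∈ l, a.1 ∈ diWalkVerts u l ∧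
      a.2 ∈ diWalkVerts u l := by
  induction l with
  | nil => simp
  | cons b l ih =>
    rintro u ⟨h1, h2, h⟩ a ha
    rcases h with h | h
    · simp at h
    have hau : b.1 = u := by simpa using h.1
    rw [List.mem_cons] at ha
    rcases ha with rfl | ha
    · simp [diWalkVerts, hau]
    · have := ih b.2 (by
        refine ⟨fun b hb => h1 b (by simp [hb]), ?_, ?_⟩
        · exact List.IsChain.tail h2
        · rcases l with _ | ⟨b, l⟩
          · simp at ha
          · right
            refine ⟨?_, ?_⟩
            · have h2 : List.IsChain _ _ := h2
              rw [List.isChain_cons_cons] at h2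
              simp [h2.1]
            · have := h.2
              rwa [List.getLast?_cons_cons] at this) a ha
      simp only [diWalkVerts, List.map_cons] at this ⊢
      exact ⟨List.mem_cons_of_mem _ this.1, List.mem_cons_of_mem _ this.2⟩

open Classical in
theorem ekm_dicut {V : Type*} [Fintype V] (D : V → V → Prop) (u v : V) (ℓ : ℕ)
    (hf : HasNodeDiFlow D u v ℓ) (C U : Finset V) (huC : u ∉ C) (hvC : v ∉ C)
    (hu : u ∈ U) (hv : v ∉ U) :
    ℓ - C.card ≤ (Finset.univ.filter fun p : V × V => p.1 ∈ U ∧ p.2 ∉ U ∧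
      D p.1 p.2 ∧ p.1 ∉ C ∧ p.2 ∉ C).card := by
  obtain ⟨f, f1, f2, f3⟩ := hf
  let Bad : Finset (Fin ℓ) := Finset.univ.filter fun i => ∃ x ∈ C, x ∈ diWalkVerts u (f i)
  have hBad : Bad.card ≤ C.card := by
    have hb : ∀ i : Fin ℓ, ∃ x, i ∈ Bad → x ∈ C ∧ x ∈ diWalkVerts u (f i) := by
      intro i
      by_cases hi : i ∈ Bad
      · obtain ⟨x, hx⟩ := (Finset.mem_filter.1 hi).2
        exact ⟨x, fun _ => hx⟩
      · exact ⟨u, fun h => absurd h hi⟩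
    choose g hg using hb
    apply Finset.card_le_card_of_injOn g
    · intro i hi; exact (hg i hi).1
    · intro i hi j hj hij
      by_contra hne
      have a := hg i hi
      have b := hg j hj
      rw [← hij] at b
      rcases f3 i j hne _ a.2 b.2 with h | h
      · exact huC (h ▸ a.1)
      · exact hvC (h ▸ a.1)
  have hc : Badᶜ.card = ℓ - Bad.card := by
    rw [Finset.card_compl, Fintype.card_fin]
  refine le_trans (by omega : ℓ - C.card ≤ Badᶜ.card) ?_
  choose g hg hgU using fun i => ekm_cross D U v hv (f i) u hu (f1 i)
  apply Finset.card_le_card_of_injOn g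
  · intro i hi
    have hi : i ∉ Bad := by simpa using hi
    have hi : ∀ x ∈ C, x ∉ diWalkVerts u (f i) := by
      simpa [Bad] using hi
    have := ekm_verts D v (f i) u (f1 i) _ (hg i)
    simp only [Finset.coe_filter, Finset.mem_univ, true_and, Set.mem_setOf_eq]
    exact ⟨(hgU i).1, (hgU i).2, (f1 i).1 _ (hg i), fun h => hi _ h this.1,
      fun h => hi _ h this.2⟩
  · intro i _ j _ hij
    by_contra hne
    exact f2 i j hne _ (hg i) (hij ▸ hg j)

theorem ekm_nec {V : Type*} [Fintype V]
    (H : SimpleGraph V) (s t : V) (hst : s ≠ t) (ℓ : ℕ) (D : V → V → Prop)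
    (hD : IsOrientation H D) (h1 : HasNodeDiFlow D s t ℓ) (h2 : HasNodeDiFlow D t s ℓ)
    (C : Finset V) (hs : s ∉ C) (ht : t ∉ C) :
    HasFlow (SimpleGraph.fromRel fun a b => H.Adj a b ∧ a ∉ C ∧ b ∉ C) s t
          (2 * (ℓ - C.card)) := by
  classical
  apply ekm_menger _ _ _ _ _ hst
  intro U hsU htU
  have a := ekm_dicut D s t ℓ h1 C U hs ht hsU htU
  have b := ekm_dicut D t s ℓ h2 C Uᶜ ht hs (by simpa using htU) (by simpa using hsU)
  set O := Finset.univ.filter fun p : V × V => p.1 ∈ U ∧ p.2 ∉ U ∧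
      D p.1 p.2 ∧ p.1 ∉ C ∧ p.2 ∉ C with hO
  set I := Finset.univ.filter fun p : V × V => p.1 ∈ Uᶜ ∧ p.2 ∉ Uᶜ ∧
      D p.1 p.2 ∧ p.1 ∉ C ∧ p.2 ∉ C with hI
  have hcI : (I.image Prod.swap).card = I.card :=
    Finset.card_image_of_injective _ Prod.swap_injective
  have hd : Disjoint O (I.image Prod.swap) := by
    rw [Finset.disjoint_left]
    rintro ⟨x, y⟩ hx hy
    rw [Finset.mem_image] at hy
    obtain ⟨⟨y', x'⟩, hy, he⟩ := hy
    obtain ⟨rfl, rfl⟩ : x' = x ∧ y' = y := Prod.mk.inj he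
    simp only [hO, hI, Finset.mem_filter] at hx hy
    exact (hD x' y').2 ⟨hx.2.2.2.1, hy.2.2.2.1⟩
  have hsub : 2 * (ℓ - C.card) ≤ (O ∪ I.image Prod.swap).card := by
    rw [Finset.card_union_of_disjoint hd]; omega
  refine hsub.trans (Finset.card_le_card ?_)
  rintro ⟨x, y⟩ hx
  rw [Finset.mem_union, Finset.mem_image] at hx
  simp only [Finset.mem_filter, Finset.mem_univ, true_and, SimpleGraph.fromRel_adj]
  rcases hx with hx | ⟨⟨y', x'⟩, hy, he⟩
  · simp only [hO, Finset.mem_filter, Finset.mem_univ, true_and] at hx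
    refine ⟨hx.1, hx.2.1, ?_, Or.inl ⟨(hD x y).1.2 (Or.inl hx.2.2.1), hx.2.2.2⟩⟩
    rintro rfl
    exact hx.2.1 hx.1
  · obtain ⟨rfl, rfl⟩ : x' = x ∧ y' = y := Prod.mk.inj he
    simp only [hI, Finset.mem_filter, Finset.mem_univ, true_and, Finset.mem_compl,
      not_not] at hy
    refine ⟨hy.2.1, hy.1, ?_, Or.inl ⟨(hD x' y').1.2 (Or.inr hy.2.2.1), hy.2.2.2.2, hy.2.2.2.1⟩⟩
    intro hxy
    exact hy.1 (hxy ▸ hy.2.1)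

/-- Egawa–Kaneko–Matsumoto: `H` has an orientation `D` with
`κ_D(s,t) ≥ ℓ` and `κ_D(t,s) ≥ ℓ` iff `λ_{H∖C}(s,t) ≥ 2(ℓ − |C|)` for every
`C ⊆ V ∖ {s,t}` with `|C| < ℓ`. -/
theorem egawa_kaneko_matsumoto
    {V : Type*} [Fintype V] [DecidableEq V]
    (H : SimpleGraph V) (s t : V) (hst : s ≠ t) (ℓ : ℕ) (hℓ : 1 ≤ ℓ) :
    (∃ D : V → V → Prop, IsOrientation H D ∧
        HasNodeDiFlow D s t ℓ ∧ HasNodeDiFlow D t s ℓ) ↔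
      ∀ C : Finset V, s ∉ C → t ∉ C → C.card < ℓ →
        HasFlow (SimpleGraph.fromRel fun a b => H.Adj a b ∧ a ∉ C ∧ b ∉ C) s t
          (2 * (ℓ - C.card)) := by
  constructor
  · rintro ⟨D, hD, h1, h2⟩ C hs ht _
    exact ekm_nec H s t hst ℓ D hD h1 h2 C hs ht
  · intro h
    exact ekm_suff H s t hst ℓ h
end

section
/- (Capacitated Menger) Let s and t be two distinct vertices in a finite undirected graph H = (V,E) with nonnegative integer capacities u(a) assigned to every a ∈ E ∪ (V ∖ {s,t}) (i.e. to every edge and to every vertex other than s and t). Then the maximum size of a multiset of s–t paths such that every edge e ∈ E lies on at most u(e) of them and every vertex v ∈ V ∖ {s,t} lies on at most u(v) of them equals min{ Σ_{a∈A} u(a) : A ⊆ E ∪ (V ∖ {s,t}) such that deleting from H the edges and vertices of A leaves no s–t path }. -/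
open Finset in
lemma cm_hall {Y : Type*} [Fintype Y] (R : Y → Y → Prop) (c : Y → ℕ) (s t : Y) (k : ℕ)
    (hs : c s = k)
    (hcut : ∀ D B : Finset Y, s ∈ D → t ∉ D → (∀ y, y ∈ B ↔ y ∉ D ∧ ∃ d ∈ D, R d y) →
      k ≤ ∑ y ∈ B, c y) :
    ∃ f : {x : (Σ y, Fin (c y)) // x.1 ≠ t} → (Σ y, Fin (c y)), Function.Injective f ∧
      ∀ x, (f x).1 ≠ s ∧ (f x = x.1 ∨ R x.1.1 (f x).1) := by
  classical
  let T : {x : (Σ y, Fin (c y)) // x.1 ≠ t} → Finset (Σ y, Fin (c y)) := fun x =>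
    univ.filter fun z => z.1 ≠ s ∧ (z = x.1 ∨ R x.1.1 z.1)
  have key : ∀ W : Finset {x : (Σ y, Fin (c y)) // x.1 ≠ t}, W.card ≤ (W.biUnion T).card := by
    intro W
    let W' : Finset (Σ y, Fin (c y)) := W.map (Function.Embedding.subtype _)
    have hW' : W'.card = W.card := card_map _
    have memW' : ∀ z, z ∈ W' ↔ ∃ x ∈ W, x.1 = z := by
      intro z; simp [W']
    let D : Finset Y := W'.image Sigma.fst
    have memD : ∀ y, y ∈ D ↔ ∃ x ∈ W, x.1.1 = y := by
      intro y; simp [D, W']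
    have h1 : W'.filter (fun z => z.1 ≠ s) ⊆ W.biUnion T := by
      intro z hz
      rw [mem_filter, memW'] at hz
      obtain ⟨⟨x, hx, rfl⟩, hz⟩ := hz
      simp only [mem_biUnion, T, mem_filter, mem_univ, true_and]
      exact ⟨x, hx, hz, Or.inl rfl⟩
    rw [← hW', ← card_filter_add_card_filter_not (s := W') (fun z => z.1 ≠ s)]
    by_cases hsD : s ∈ D
    · let B : Finset Y := univ.filter fun y => y ∉ D ∧ ∃ d ∈ D, R d y
      have htD : t ∉ D := by
        rw [memD]; rintro ⟨x, _, hx⟩; exact x.2 hx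
      have hB := hcut D B hsD htD (by simp [B])
      let B' : Finset (Σ y, Fin (c y)) := B.sigma fun _ => univ
      have hB' : B'.card = ∑ y ∈ B, c y := by simp [B', card_sigma]
      have h2 : B' ⊆ W.biUnion T := by
        rintro ⟨y, j⟩ hz
        simp only [B', mem_sigma, mem_univ, and_true, B, mem_filter, true_and] at hz
        obtain ⟨hy, d, hd, hR⟩ := hz
        obtain ⟨x, hx, rfl⟩ := (memD d).1 hd
        simp only [mem_biUnion, T, mem_filter, mem_univ, true_and]
        refine ⟨x, hx, ?_, Or.inr hR⟩
        rintro rfl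
        exact hy hsD
      have h3 : Disjoint (W'.filter (fun z => z.1 ≠ s)) B' := by
        rw [disjoint_left]
        rintro z hz hz'
        simp only [B', mem_sigma, mem_univ, and_true, B, mem_filter, true_and] at hz hz'
        exact hz'.1 (mem_image_of_mem _ hz.1)
      have h4 : (W'.filter (fun z => ¬ z.1 ≠ s)).card ≤ k := by
        have : W'.filter (fun z => ¬ z.1 ≠ s) ⊆
            ({s} : Finset Y).sigma fun y => (univ : Finset (Fin (c y))) := by
          intro z hz
          simp only [mem_filter, not_not] at hz
          simp [hz.2]
        refine (card_le_card this).trans ?_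
        simp [card_sigma, hs]
      have h5 := card_le_card (union_subset h1 h2)
      rw [card_union_of_disjoint h3] at h5
      omega
    · have : W'.filter (fun z => ¬ z.1 ≠ s) = ∅ := by
        ext z
        simp only [mem_filter, not_not, notMem_empty, iff_false]
        rintro ⟨hz, rfl⟩
        exact hsD (mem_image_of_mem _ hz)
      rw [this, card_empty, add_zero]
      exact card_le_card h1
  obtain ⟨f, hf, hfT⟩ := (Finset.all_card_le_biUnion_card_iff_exists_injective T).1 key
  refine ⟨f, hf, fun x => ?_⟩
  have := hfT x
  simpa [T] using this

lemma cm_orbits {X : Type*} [Finite X] (S T : Set X) (hST : Disjoint S T) (R : X → X → Prop)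
    (f : {x // x ∉ T} → X) (hf : Function.Injective f)
    (h : ∀ x, f x ∉ S ∧ (f x = x.1 ∨ R x.1 (f x))) :
    ∃ P : X → Set X, (∀ x ∈ S, x ∈ P x ∧ ∃ y ∈ T, y ∈ P x ∧
        Relation.ReflTransGen (fun a b => R a b ∧ a ∈ P x ∧ b ∈ P x) x y) ∧
      ∀ x ∈ S, ∀ y ∈ S, ∀ z, z ∈ P x → z ∈ P y → x = y := by
  classical
  let g : X → X := fun x => if hx : x ∉ T then f ⟨x, hx⟩ else x
  have gval : ∀ x (hx : x ∉ T), g x = f ⟨x, hx⟩ := fun x hx => by simp [g, hx]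
  have ginj : ∀ x y, x ∉ T → y ∉ T → g x = g y → x = y := by
    intro x y hx hy hxy
    rw [gval x hx, gval y hy] at hxy
    exact congrArg Subtype.val (hf hxy)
  have gS : ∀ x, x ∉ T → g x ∉ S := fun x hx => by rw [gval x hx]; exact (h _).1
  -- cancellation
  have cancel : ∀ m d x y, (∀ l < m, g^[l] x ∉ T) → (∀ l < m + d, g^[l] y ∉ T) →
      x ∈ S → g^[m] x = g^[m + d] y → d = 0 ∧ x = y := by
    intro m
    induction m with
    | zero =>
      intro d x y _ hy hxS he
      rcases d with _ | d
      · exact ⟨rfl, he⟩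
      · exfalso
        rw [zero_add, Function.iterate_succ_apply'] at he
        have := gS (g^[d] y) (hy d (by omega))
        rw [← he] at this
        exact this hxS
    | succ m ih =>
      intro d x y hx hy hxS he
      refine ih d x y (fun l hl => hx l (by omega)) (fun l hl => hy l (by omega)) hxS ?_
      rw [show m + 1 + d = (m + d) + 1 by omega, Function.iterate_succ_apply',
        Function.iterate_succ_apply'] at he
      exact ginj _ _ (hx m (by omega)) (hy (m + d) (by omega)) he
  have reach : ∀ x ∈ S, ∃ n, g^[n] x ∈ T := by
    intro x hx
    by_contra hcon
    push Not at hcon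
    obtain ⟨m, n, hmn, he⟩ := Finite.exists_ne_map_eq_of_infinite (fun n => g^[n] x)
    rcases Nat.lt_or_gt_of_ne hmn with hlt | hlt
    · obtain ⟨d, rfl⟩ := Nat.exists_eq_add_of_lt hlt
      have := (cancel m (d + 1) x x (fun l _ => hcon l) (fun l _ => hcon l) hx he).1
      omega
    · obtain ⟨d, rfl⟩ := Nat.exists_eq_add_of_lt hlt
      have := (cancel n (d + 1) x x (fun l _ => hcon l) (fun l _ => hcon l) hx he.symm).1
      omega
  let P : X → Set X := fun x => {z | ∃ n, (∀ l < n, g^[l] x ∉ T) ∧ g^[n] x = z}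
  refine ⟨P, ?_, ?_⟩
  · intro x hx
    refine ⟨⟨0, by simp, rfl⟩, ?_⟩
    let N := Nat.find (reach x hx)
    have hN : g^[N] x ∈ T := Nat.find_spec (reach x hx)
    have hlt : ∀ l < N, g^[l] x ∉ T := fun l hl => Nat.find_min (reach x hx) hl
    have hP : ∀ n ≤ N, g^[n] x ∈ P x := fun n hn => ⟨n, fun l hl => hlt l (by omega), rfl⟩
    refine ⟨_, hN, hP N le_rfl, ?_⟩
    have : ∀ n ≤ N, Relation.ReflTransGen (fun a b => R a b ∧ a ∈ P x ∧ b ∈ P x) x (g^[n] x) := by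
      intro n
      induction n with
      | zero => intro _; exact .refl
      | succ n ih =>
        intro hn
        refine (ih (by omega)).tail ⟨?_, hP n (by omega), hP _ hn⟩
        rw [Function.iterate_succ_apply']
        have hnT := hlt n (by omega)
        rw [gval _ hnT]
        rcases (h ⟨_, hnT⟩).2 with he | he
        · exfalso
          rw [← gval _ hnT] at he
          have hfix : ∀ m, g^[m] (g^[n] x) = g^[n] x := fun m => Function.iterate_fixed he m
          have := hfix (N - n)
          rw [← Function.iterate_add_apply, show N - n + n = N by omega] at this
          rw [this] at hN
          exact hnT hN
        · exact he
    exact this N le_rfl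
  · rintro x hx y hy z ⟨m, hm, rfl⟩ ⟨n, hn, he⟩
    rcases le_total m n with hle | hle
    · obtain ⟨d, rfl⟩ := Nat.exists_eq_add_of_le hle
      exact (cancel m d x y hm hn hx he.symm).2
    · obtain ⟨d, rfl⟩ := Nat.exists_eq_add_of_le hle
      exact (cancel n d y x hn hm hy he).2.symm

/-- incidence relation of the subdivided graph -/
def cmR {V : Type*} (H : SimpleGraph V) : V ⊕ Sym2 V → V ⊕ Sym2 V → Prop
  | .inl v, .inr e => v ∈ e ∧ e ∈ H.edgeSet
  | .inr e, .inl v => v ∈ e ∧ e ∈ H.edgeSet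
  | _, _ => False

lemma cm_walk {V : Type*} (H : SimpleGraph V) (P : V ⊕ Sym2 V → Prop) (a : V) (ha : P (.inl a))
    (z : V ⊕ Sym2 V)
    (hz : Relation.ReflTransGen (fun x y => cmR H x y ∧ P x ∧ P y) (.inl a) z) :
    ∃ b, (z = .inl b ∨ ∃ e, z = .inr e ∧ P (.inr e) ∧ b ∈ e ∧ e ∈ H.edgeSet) ∧
      ∃ w : H.Walk a b, (∀ v ∈ w.support, P (.inl v)) ∧ ∀ e ∈ w.edges, P (.inr e) := by
  induction hz with
  | refl => exact ⟨a, Or.inl rfl, .nil, by simpa using ha, by simp⟩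
  | @tail y z _ hyz ih =>
    obtain ⟨b, hb, w, hw1, hw2⟩ := ih
    obtain ⟨hR, hPy, hPz⟩ := hyz
    rcases hb with rfl | ⟨e, rfl, hPe, hbe, heH⟩
    · rcases z with v | e
      · exact hR.elim
      · exact ⟨b, Or.inr ⟨e, rfl, hPz, hR.1, hR.2⟩, w, hw1, hw2⟩
    · rcases z with v | e'
      · by_cases hvb : v = b
        · subst hvb
          exact ⟨v, Or.inl rfl, w, hw1, hw2⟩
        · have he : e = s(b, v) := (Sym2.mem_and_mem_iff (Ne.symm hvb)).1 ⟨hbe, hR.1⟩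
          subst he
          have hadj : H.Adj b v := heH
          refine ⟨v, Or.inl rfl, w.concat hadj, ?_, ?_⟩
          · intro x hx
            rw [SimpleGraph.Walk.support_concat] at hx
            simp only [List.concat_eq_append, List.mem_append, List.mem_singleton] at hx
            rcases hx with hx | rfl
            · exact hw1 x hx
            · exact hPz
          · intro x hx
            rw [SimpleGraph.Walk.edges_concat] at hx
            simp only [List.concat_eq_append, List.mem_append, List.mem_singleton] at hx
            rcases hx with hx | rfl
            · exact hw2 x hx
            · exact hPe
      · exact hR.elim

lemma cm_reach {V : Type*} (H : SimpleGraph V) (AE : Finset (Sym2 V)) (AV : Finset V)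
    {a b : V} (w : H.Walk a b) (h1 : ∀ e ∈ w.edges, e ∉ AE) (h2 : ∀ v ∈ w.support, v ∉ AV) :
    (SimpleGraph.fromRel fun a b =>
            H.Adj a b ∧ s(a, b) ∉ AE ∧ a ∉ AV ∧ b ∉ AV).Reachable a b := by
  induction w with
  | nil => exact .refl _
  | cons h p ih =>
    refine SimpleGraph.Reachable.trans (SimpleGraph.Adj.reachable ?_)
      (ih (fun e he => h1 e (by simp [he])) (fun v hv => h2 v (by simp [hv])))
    rw [SimpleGraph.fromRel_adj]
    exact ⟨h.ne, Or.inl ⟨h, h1 _ (by simp), h2 _ (by simp), h2 _ (by simp)⟩⟩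

lemma cm_le {V : Type*} [DecidableEq V]
    (H : SimpleGraph V) (s t : V) (ue : Sym2 V → ℕ) (uv : V → ℕ) (n : ℕ)
    (f : Fin n → H.Walk s t)
    (hE : ∀ e : Sym2 V, {i : Fin n | e ∈ (f i).edges}.ncard ≤ ue e)
    (hV : ∀ v : V, v ≠ s → v ≠ t → {i : Fin n | v ∈ (f i).support}.ncard ≤ uv v)
    (AE : Finset (Sym2 V)) (AV : Finset V) (hs : s ∉ AV) (ht : t ∉ AV)
    (hr : ¬ (SimpleGraph.fromRel fun a b =>
            H.Adj a b ∧ s(a, b) ∉ AE ∧ a ∉ AV ∧ b ∉ AV).Reachable s t) :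
    n ≤ AE.sum ue + AV.sum uv := by
  classical
  have hcov : (Finset.univ : Finset (Fin n)) ⊆
      (AE.biUnion fun e => Finset.univ.filter fun i => e ∈ (f i).edges) ∪
      (AV.biUnion fun v => Finset.univ.filter fun i => v ∈ (f i).support) := by
    intro i _
    by_contra hi
    simp only [Finset.mem_union, Finset.mem_biUnion, Finset.mem_filter, Finset.mem_univ,
      true_and, not_or, not_exists, not_and] at hi
    exact hr (cm_reach H AE AV (f i) (fun e he hA => hi.1 e hA he) (fun v hv hA => hi.2 v hA hv))
  have h1 := Finset.card_le_card hcov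
  rw [Finset.card_univ, Fintype.card_fin] at h1
  refine h1.trans ((Finset.card_union_le _ _).trans (Nat.add_le_add ?_ ?_))
  · refine Finset.card_biUnion_le.trans (Finset.sum_le_sum fun e _ => ?_)
    have := hE e
    rwa [Set.ncard_eq_toFinset_card', Set.toFinset_setOf] at this
  · refine Finset.card_biUnion_le.trans (Finset.sum_le_sum fun v hv => ?_)
    have := hV v (by rintro rfl; exact hs hv) (by rintro rfl; exact ht hv)
    rwa [Set.ncard_eq_toFinset_card', Set.toFinset_setOf] at this

lemma cm_exists {V : Type*} [Fintype V] [DecidableEq V]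
    (H : SimpleGraph V) (s t : V) (hst : s ≠ t) (ue : Sym2 V → ℕ) (uv : V → ℕ) (k : ℕ)
    (hk : ∀ (AE : Finset (Sym2 V)) (AV : Finset V),
        ↑AE ⊆ H.edgeSet → s ∉ AV → t ∉ AV →
        ¬ (SimpleGraph.fromRel fun a b =>
            H.Adj a b ∧ s(a, b) ∉ AE ∧ a ∉ AV ∧ b ∉ AV).Reachable s t →
        k ≤ AE.sum ue + AV.sum uv) :
    ∃ f : Fin k → H.Walk s t, (∀ i, (f i).IsPath) ∧
        (∀ e : Sym2 V, {i : Fin k | e ∈ (f i).edges}.ncard ≤ ue e) ∧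
        (∀ v : V, v ≠ s → v ≠ t → {i : Fin k | v ∈ (f i).support}.ncard ≤ uv v) := by
  classical
  let c : V ⊕ Sym2 V → ℕ := Sum.elim (fun v => if v = s ∨ v = t then k else uv v) ue
  have hcs : c (.inl s) = k := by simp [c]
  have hct : c (.inl t) = k := by simp [c]
  obtain ⟨f, hf, hfR⟩ := cm_hall (cmR H) c (.inl s) (.inl t) k hcs (by
    intro D B hsD htD hB
    by_cases htB : Sum.inl t ∈ B
    · calc k = c (.inl t) := hct.symm
        _ ≤ _ := Finset.single_le_sum (f := c) (fun _ _ => Nat.zero_le _) htB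
    · have hsB : Sum.inl s ∉ B := fun h => ((hB _).1 h).1 hsD
      have hkk := hk B.toRight B.toLeft ?_ (by simpa using hsB) (by simpa using htB) ?_
      · refine hkk.trans (le_of_eq ?_)
        conv_rhs => rw [← Finset.toLeft_disjSum_toRight (u := B), Finset.sum_disjSum]
        rw [add_comm]
        congr 1
        refine Finset.sum_congr rfl fun v hv => ?_
        rw [Finset.mem_toLeft] at hv
        have h1 : v ≠ s := by rintro rfl; exact hsB hv
        have h2 : v ≠ t := by rintro rfl; exact htB hv
        simp [c, h1, h2]
      · intro e he
        have he' : Sum.inr e ∈ B := by simpa using he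
        obtain ⟨_, d, _, hR⟩ := (hB _).1 he'
        rcases d with v | e'
        · exact hR.2
        · exact hR.elim
      · rintro ⟨w⟩
        have : ∀ a b (w : (SimpleGraph.fromRel fun a b =>
            H.Adj a b ∧ s(a, b) ∉ B.toRight ∧ a ∉ B.toLeft ∧ b ∉ B.toLeft).Walk a b),
            Sum.inl a ∈ D → Sum.inl b ∈ D := by
          intro a b w
          induction w with
          | nil => exact id
          | @cons a b _ hab p ih =>
            intro haD
            apply ih
            rw [SimpleGraph.fromRel_adj] at hab
            have hab' : H.Adj a b ∧ s(a, b) ∉ B.toRight ∧ b ∉ B.toLeft := by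
              rcases hab.2 with h | h
              · exact ⟨h.1, h.2.1, h.2.2.2⟩
              · exact ⟨h.1.symm, by rw [Sym2.eq_swap]; exact h.2.1, h.2.2.1⟩
            obtain ⟨hadj, he, hb⟩ := hab'
            rw [Finset.mem_toRight] at he
            rw [Finset.mem_toLeft] at hb
            have heD : Sum.inr s(a, b) ∈ D := by
              by_contra hn
              exact he ((hB _).2 ⟨hn, _, haD, Sym2.mem_mk_left a b, hadj⟩)
            by_contra hn
            exact hb ((hB _).2 ⟨hn, _, heD, Sym2.mem_mk_right a b, hadj⟩)
        exact htD (this s t w hsD))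
  obtain ⟨P, hP1, hP2⟩ := cm_orbits (X := Σ y, Fin (c y)) {x | x.1 = .inl s} {x | x.1 = .inl t}
    (by
      rw [Set.disjoint_left]
      intro x hx hx'
      exact hst (Sum.inl_injective (hx.symm.trans hx')))
    (fun x y => cmR H x.1 y.1) f hf hfR
  let src : Fin k → Σ y, Fin (c y) := fun i => ⟨.inl s, Fin.cast hcs.symm i⟩
  have hsrc : Function.Injective src := by
    intro i j hij
    simpa [src] using hij
  have hw : ∀ i, ∃ w : H.Walk s t, w.IsPath ∧
      (∀ v ∈ w.support, ∃ x ∈ P (src i), x.1 = .inl v) ∧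
      (∀ e ∈ w.edges, ∃ x ∈ P (src i), x.1 = .inr e) := by
    intro i
    obtain ⟨hx, y, hyT, hyP, hr⟩ := hP1 (src i) rfl
    have hr' := hr.lift (p := fun a b => cmR H a b ∧ (∃ x ∈ P (src i), x.1 = a) ∧
      (∃ x ∈ P (src i), x.1 = b)) Sigma.fst
      (fun a b hab => ⟨hab.1, ⟨a, hab.2.1, rfl⟩, ⟨b, hab.2.2, rfl⟩⟩)
    rw [Function.onFun_apply, show y.1 = .inl t from hyT] at hr'
    obtain ⟨b, hb, w, hw1, hw2⟩ :=
      cm_walk H (fun a => ∃ x ∈ P (src i), x.1 = a) s ⟨_, hx, rfl⟩ _ hr'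
    rcases hb with hb | ⟨e, he, _⟩
    · obtain rfl := Sum.inl_injective hb
      exact ⟨w.bypass, w.bypass_isPath, fun v hv => hw1 v (w.support_bypass_subset hv),
        fun e he => hw2 e (w.edges_bypass_subset he)⟩
    · cases he
  choose w hpath hsup hedge using hw
  have count : ∀ (y : V ⊕ Sym2 V) (I : Set (Fin k)), (∀ i ∈ I, ∃ x ∈ P (src i), x.1 = y) →
      I.ncard ≤ c y := by
    intro y I hI
    have hI' : ∀ i : I, ∃ j : Fin (c y), (⟨y, j⟩ : Σ y, Fin (c y)) ∈ P (src i) := by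
      rintro ⟨i, hi⟩
      obtain ⟨⟨y', j⟩, hx, rfl⟩ := hI i hi
      exact ⟨j, hx⟩
    choose g hg using hI'
    have hginj : Function.Injective g := by
      intro i j hij
      have h1 := hg i
      rw [hij] at h1
      exact Subtype.ext (hsrc (hP2 _ rfl _ rfl _ h1 (hg j)))
    have := Nat.card_le_card_of_injective g hginj
    rwa [Nat.card_coe_set_eq, Nat.card_fin] at this
  refine ⟨w, hpath, fun e => count (.inr e) _ fun i hi => hedge i e hi, fun v hvs hvt => ?_⟩
  have := count (.inl v) {i | v ∈ (w i).support} fun i hi => hsup i v hi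
  simpa [c, hvs, hvt] using this

/-- capacitated Menger: the maximum number of `s`–`t` paths such that
every edge `e` lies on at most `ue e` of them and every vertex `v ∉ {s,t}` lies on at
most `uv v` of them equals the minimum total capacity of a set `A` of edges and
vertices (other than `s,t`) whose deletion leaves no `s`–`t` path. -/
theorem capacitated_menger
    {V : Type*} [Fintype V] [DecidableEq V]
    (H : SimpleGraph V) (s t : V) (hst : s ≠ t) (ue : Sym2 V → ℕ) (uv : V → ℕ) :
    sSup {n : ℕ | ∃ f : Fin n → H.Walk s t, (∀ i, (f i).IsPath) ∧
        (∀ e : Sym2 V, {i : Fin n | e ∈ (f i).edges}.ncard ≤ ue e) ∧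
        (∀ v : V, v ≠ s → v ≠ t → {i : Fin n | v ∈ (f i).support}.ncard ≤ uv v)} =
      sInf {m : ℕ | ∃ (AE : Finset (Sym2 V)) (AV : Finset V),
        ↑AE ⊆ H.edgeSet ∧ s ∉ AV ∧ t ∉ AV ∧
        ¬ (SimpleGraph.fromRel fun a b =>
            H.Adj a b ∧ s(a, b) ∉ AE ∧ a ∉ AV ∧ b ∉ AV).Reachable s t ∧
        m = AE.sum ue + AV.sum uv} := by
  classical
  set M := {m : ℕ | ∃ (AE : Finset (Sym2 V)) (AV : Finset V),
        ↑AE ⊆ H.edgeSet ∧ s ∉ AV ∧ t ∉ AV ∧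
        ¬ (SimpleGraph.fromRel fun a b =>
            H.Adj a b ∧ s(a, b) ∉ AE ∧ a ∉ AV ∧ b ∉ AV).Reachable s t ∧
        m = AE.sum ue + AV.sum uv} with hM
  have hne : M.Nonempty := by
    refine ⟨_, H.edgeFinset, ∅, by simp, by simp, by simp, ?_, rfl⟩
    rintro ⟨w⟩
    cases w with
    | nil => exact hst rfl
    | cons h p =>
      rw [SimpleGraph.fromRel_adj] at h
      rcases h.2 with h | h
      · exact h.2.1 (by simpa using h.1)
      · exact h.2.1 (by simpa using h.1)
  obtain ⟨AE, AV, h1, h2, h3, h4, h5⟩ := Nat.sInf_mem hne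
  apply IsGreatest.csSup_eq
  constructor
  · exact cm_exists H s t hst ue uv (sInf M) fun AE AV h1 h2 h3 h4 =>
      Nat.sInf_le ⟨AE, AV, h1, h2, h3, h4, rfl⟩
  · rintro n ⟨f, _, hE, hV⟩
    rw [h5]
    exact cm_le H s t ue uv n f hE hV AE AV h2 h3 h4
end
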